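/- Let X be a homogeneous polynomial vector field on S² of degree 2. Then every periodic orbit γ of X on S² is convex: for every p∈γ, either the great circle tangent to γ at p intersects γ only at p, or γ is entirely contained in that great circle. -/

import Mathlib

open MvPolynomial

/-- The sphere `S² ⊆ ℝ³`. -/
def S2 : Set (Fin 3 → ℝ) := {p | p 0 ^ 2 + p 1 ^ 2 + p 2 ^ 2 = 1}

/-- The vector field in `ℝ³` associated to the polynomials `P`, `Q`, `R`. -/
noncomputable def Xf (P Q R : MvPolynomial (Fin 3) ℝ) (p : Fin 3 → ℝ) : Fin 3 → ℝ :=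
  ![eval p P, eval p Q, eval p R]

/-- `Γ` is a periodic orbit of the vector field `X` on `S²`: the image of a nonconstant
periodic solution of `X` contained in `S²`. -/
def IsPeriodicOrbitOn (X : (Fin 3 → ℝ) → (Fin 3 → ℝ)) (Γ : Set (Fin 3 → ℝ)) : Prop :=
  ∃ (γ : ℝ → Fin 3 → ℝ) (T : ℝ),
    (∀ t, HasDerivAt γ (X (γ t)) t) ∧ 0 < T ∧ (∀ t, γ (t + T) = γ t) ∧
    (¬ ∀ t, γ t = γ 0) ∧ Set.range γ ⊆ S2 ∧ Γ = Set.range γ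

/-- Euclidean dot product on `ℝ³`. -/
def dot3 (m p : Fin 3 → ℝ) : ℝ := m 0 * p 0 + m 1 * p 1 + m 2 * p 2

/-- Cross product on `ℝ³`. -/
def cross3 (m p : Fin 3 → ℝ) : Fin 3 → ℝ :=
  ![m 1 * p 2 - m 2 * p 1, m 2 * p 0 - m 0 * p 2, m 0 * p 1 - m 1 * p 0]

section OrbitConvexity

open Set Filter Topology

section OneSided

lemma HasDerivAt.nonneg_of_le_right {f : ℝ → ℝ} {f' x b : ℝ} (h : HasDerivAt f f' x) (hb : x < b)
    (hf : ∀ y ∈ Ioo x b, f x ≤ f y) : 0 ≤ f' := by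
  have h1 := (hasDerivWithinAt_iff_tendsto_slope' (by simp)).1 (h.hasDerivWithinAt (s := Ioi x))
  refine ge_of_tendsto h1 ?_
  filter_upwards [Ioo_mem_nhdsGT hb] with y hy
  rw [slope_def_field]
  exact div_nonneg (sub_nonneg.2 (hf y hy)) (sub_nonneg.2 hy.1.le)

lemma HasDerivAt.nonpos_of_le_left {f : ℝ → ℝ} {f' x a : ℝ} (h : HasDerivAt f f' x) (ha : a < x)
    (hf : ∀ y ∈ Ioo a x, f x ≤ f y) : f' ≤ 0 := by
  have h1 : HasDerivAt (fun y => f (-y)) (-f') (-x) := by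
    simpa using HasDerivAt.comp_const_sub 0 (-x) (f := f) (by simpa using h)
  have := h1.nonneg_of_le_right (b := -a) (by linarith) (fun y hy => by
    simpa using hf (-y) ⟨by linarith [hy.2], by linarith [hy.1]⟩)
  linarith

lemma HasDerivAt.eq_zero_of_le {f : ℝ → ℝ} {f' x a b : ℝ} (h : HasDerivAt f f' x) (ha : a < x)
    (hb : x < b) (hf : ∀ y ∈ Ioo a b, f x ≤ f y) : f' = 0 :=
  le_antisymm (h.nonpos_of_le_left ha fun y hy => hf y ⟨hy.1, hy.2.trans hb⟩)
    (h.nonneg_of_le_right hb fun y hy => hf y ⟨ha.trans hy.1, hy.2⟩)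

end OneSided

/-- The properties of the function `G s t = det (γ s, γ' s, γ t)` attached to a simple closed
curve `γ` of period `T` without inflections nor bitangents; `Gs` and `Gt` are its partial
derivatives and `κ` is the (positive) geodesic curvature. -/
structure TangentKernel (T : ℝ) (G Gs Gt : ℝ → ℝ → ℝ) (κ : ℝ → ℝ) : Prop where
  cont : Continuous fun x : ℝ × ℝ => G x.1 x.2
  hasDerivAt_left : ∀ s t, HasDerivAt (fun u => G u t) (Gs s t) s
  hasDerivAt_right : ∀ s t, HasDerivAt (fun u => G s u) (Gt s t) t
  periodic : ∀ s t, G s (t + T) = G s t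
  kappa_pos : ∀ s, 0 < κ s
  near : ∃ δ > 0, ∀ s t, s ≠ t → |s - t| < δ → 0 < G s t
  left_ne : ∀ s t, s ≠ t → |s - t| < T → G s t = 0 → Gs s t ≠ 0
  right_ne : ∀ s t, s ≠ t → |s - t| < T → G s t = 0 → Gt s t ≠ 0
  swap_ne : ∀ s t, s ≠ t → |s - t| < T → G s t = 0 → G t s ≠ 0
  collinear : ∀ s a b, G s a = 0 → G s b = 0 → 0 < Gs s a * Gs s b → Gs s a * Gt s a < 0 →
    0 ≤ G a b → Gs s b * Gt s b < 0
  chain : ∀ a s b, G a s = 0 → G s b = 0 → κ s * G a b = -(Gs s b * Gt a s)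

namespace TangentKernel

variable {T : ℝ} {G Gs Gt : ℝ → ℝ → ℝ} {κ : ℝ → ℝ}

lemma reverse (h : TangentKernel T G Gs Gt κ) (c : ℝ) :
    TangentKernel T (fun s t => G (c - s) (c - t)) (fun s t => -Gs (c - s) (c - t))
      (fun s t => -Gt (c - s) (c - t)) (fun s => κ (c - s)) where
  cont := h.cont.comp (f := fun x : ℝ × ℝ => (c - x.1, c - x.2)) (by fun_prop)
  hasDerivAt_left s t := (h.hasDerivAt_left (c - s) (c - t)).comp_const_sub c s
  hasDerivAt_right s t := (h.hasDerivAt_right (c - s) (c - t)).comp_const_sub c t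
  periodic s t := by
    have := h.periodic (c - s) (c - (t + T))
    rw [← this]; congr 1; ring
  kappa_pos s := h.kappa_pos _
  near := by
    obtain ⟨δ, hδ, H⟩ := h.near
    refine ⟨δ, hδ, fun s t hst hd => H _ _ (by simpa using hst) ?_⟩
    rwa [show c - s - (c - t) = -(s - t) by ring, abs_neg]
  left_ne s t hst hd h0 := neg_ne_zero.2 <| h.left_ne _ _ (by simpa using hst)
    (by rwa [show c - s - (c - t) = -(s - t) by ring, abs_neg]) h0
  right_ne s t hst hd h0 := neg_ne_zero.2 <| h.right_ne _ _ (by simpa using hst)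
    (by rwa [show c - s - (c - t) = -(s - t) by ring, abs_neg]) h0
  swap_ne s t hst hd h0 := h.swap_ne _ _ (by simpa using hst)
    (by rwa [show c - s - (c - t) = -(s - t) by ring, abs_neg]) h0
  collinear s a b h1 h2 h3 h4 h5 := by
    simp only [neg_mul_neg] at *
    exact h.collinear _ _ _ h1 h2 h3 h4 h5
  chain a s b h1 h2 := by
    simp only [neg_mul_neg]
    exact h.chain _ _ _ h1 h2

/-- An arc on which `G` is nonnegative cannot end at a point whose tangent passes through the
initial point of the arc: the rest of the curve would be trapped. -/
lemma end_ne_zero (h : TangentKernel T G Gs Gt κ) {τ : ℝ} (h0 : 0 < τ) (hT : τ < T)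
    (hG : ∀ s ∈ Icc 0 τ, ∀ t ∈ Icc 0 τ, 0 ≤ G s t) : G τ 0 ≠ 0 := by
  intro hz
  obtain ⟨δ, hδ, near⟩ := h.near
  have dist0 : |τ - 0| < T := by rw [abs_of_pos] <;> linarith
  have gs0 : Gs τ 0 < 0 := by
    refine lt_of_le_of_ne ((h.hasDerivAt_left τ 0).nonpos_of_le_left h0 fun y hy => ?_)
      (h.left_ne τ 0 h0.ne' dist0 hz)
    rw [hz]; exact hG y ⟨hy.1.le, hy.2.le⟩ 0 ⟨le_rfl, h0.le⟩
  have gt0 : 0 < Gt τ 0 := by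
    refine lt_of_le_of_ne ((h.hasDerivAt_right τ 0).nonneg_of_le_right h0 fun y hy => ?_)
      (h.right_ne τ 0 h0.ne' dist0 hz).symm
    rw [hz]; exact hG τ ⟨h0.le, le_rfl⟩ y ⟨hy.1.le, hy.2.le⟩
  obtain ⟨T', hτT', hT'T, hneg⟩ : ∃ T', τ < T' ∧ T' < T ∧ G τ T' < 0 := by
    by_contra! hc
    have hd : HasDerivAt (fun u => G τ u) (Gt τ 0) T := by
      have h1 := (h.hasDerivAt_right τ 0)
      rw [show (0 : ℝ) = T - T by ring] at h1
      have h2 := h1.comp_sub_const T T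
      rw [show T - T = (0 : ℝ) by ring] at h2
      refine h2.congr_of_eventuallyEq (Eventually.of_forall fun u => ?_)
      simpa using h.periodic τ (u - T)
    have hTz : G τ T = 0 := by rw [← hz, ← h.periodic τ 0, zero_add]
    have := hd.nonpos_of_le_left hT (fun y hy => by rw [hTz]; exact hc y hy.1 hy.2)
    linarith
  let K : Set (ℝ × ℝ) := (Icc 0 τ ×ˢ Icc τ T') ∩ {x : ℝ × ℝ | G x.1 x.2 ≤ 0 ∧ δ ≤ x.2 - x.1}
  have hK : IsCompact K := (isCompact_Icc.prod isCompact_Icc).inter_right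
    ((isClosed_le h.cont continuous_const).inter (isClosed_le continuous_const (continuous_snd.sub continuous_fst)))
  have hne : K.Nonempty := by
    refine ⟨(τ, T'), ⟨⟨h0.le, le_rfl⟩, hτT'.le, le_rfl⟩, hneg.le, ?_⟩
    by_contra! hc
    have := near τ T' hτT'.ne (by rw [abs_sub_comm, abs_of_pos] <;> simpa using ‹_›)
    linarith
  obtain ⟨⟨s, t⟩, ⟨⟨hs, ht⟩, hle, hst⟩, hmin⟩ := hK.exists_isMinOn hne continuous_snd.continuousOn
  simp only at hs ht hle hst
  have hbefore : ∀ u ∈ Icc 0 τ, ∀ v ∈ Ico τ t, u ≠ v → 0 < G u v := by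
    intro u hu v hv huv
    by_cases hd : v - u < δ
    · refine near u v huv ?_
      rw [abs_sub_comm, abs_of_nonneg (by linarith [hu.2, hv.1])]; exact hd
    · by_contra! hc
      have := hmin (show (u, v) ∈ K from
        ⟨⟨hu, hv.1, hv.2.le.trans ht.2⟩, hc, not_lt.1 hd⟩)
      exact absurd this (not_le.2 hv.2)
  have hst' : s ≠ t := by rintro rfl; linarith
  have hdist : |s - t| < T := by
    rw [abs_sub_comm, abs_of_nonneg] <;> linarith [hs.1, ht.2]
  have hnonneg : ∀ u ∈ Icc 0 τ, 0 ≤ G u t := by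
    intro u hu
    rcases eq_or_lt_of_le ht.1 with rfl | hlt
    · exact hG u hu τ ⟨h0.le, le_rfl⟩
    · have h1 : Tendsto (fun v => G u v) (𝓝[<] t) (𝓝 (G u t)) :=
        (h.hasDerivAt_right u t).continuousAt.mono_left nhdsWithin_le_nhds
      refine ge_of_tendsto h1 ?_
      filter_upwards [Ioo_mem_nhdsLT hlt] with v hv
      exact (hbefore u hu v ⟨hv.1.le, hv.2⟩ (by linarith [hu.2, hv.1] |> ne_of_lt)).le
  have hzero : G s t = 0 := le_antisymm hle (hnonneg s hs)
  have hgs := h.left_ne s t hst' hdist hzero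
  have hs0τ : s = 0 ∨ s = τ := by
    by_contra! hc
    refine hgs ((h.hasDerivAt_left s t).eq_zero_of_le (lt_of_le_of_ne hs.1 hc.1.symm)
      (lt_of_le_of_ne hs.2 hc.2) fun y hy => ?_)
    rw [hzero]; exact hnonneg y ⟨hy.1.le, hy.2.le⟩
  have htτ : τ < t := by
    refine lt_of_le_of_ne ht.1 ?_
    rintro rfl
    rcases hs0τ with rfl | rfl
    · exact h.swap_ne _ _ hst' hdist hzero hz
    · exact hst' rfl
  rcases hs0τ with rfl | rfl
  · have h1 : 0 ≤ Gs 0 t := (h.hasDerivAt_left 0 t).nonneg_of_le_right h0 fun y hy => by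
      rw [hzero]; exact hnonneg y ⟨hy.1.le, hy.2.le⟩
    have h2 : 0 < Gs 0 t := lt_of_le_of_ne h1 hgs.symm
    have h3 := h.chain τ 0 t hz hzero
    have h4 := mul_nonneg (h.kappa_pos 0).le (hnonneg τ ⟨h0.le, le_rfl⟩)
    have h5 := mul_pos h2 gt0
    linarith
  · have h1 : Gs s t < 0 := lt_of_le_of_ne
      ((h.hasDerivAt_left s t).nonpos_of_le_left h0 fun y hy => by
        rw [hzero]; exact hnonneg y ⟨hy.1.le, hy.2.le⟩) hgs
    have h2 : Gt s t ≤ 0 := (h.hasDerivAt_right s t).nonpos_of_le_left htτ fun y hy => by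
      rw [hzero]; exact (hbefore s hs y ⟨hy.1.le, hy.2⟩ hy.1.ne).le
    have h3 := h.collinear s 0 t hz hzero (mul_pos_of_neg_of_neg gs0 h1)
      (mul_neg_of_neg_of_pos gs0 gt0) (hnonneg 0 ⟨le_rfl, h0.le⟩)
    have h4 := mul_nonneg_of_nonpos_of_nonpos h1.le h2
    linarith

lemma pos_of_mem_Ico (h : TangentKernel T G Gs Gt κ) {p q : ℝ} (hp : p ∈ Ico 0 T)
    (hq : q ∈ Ico 0 T) (hpq : p ≠ q) : 0 < G p q := by
  by_contra! hc
  obtain ⟨δ, hδ, near⟩ := h.near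
  let M := max p q
  have hMT : M < T := max_lt hp.2 hq.2
  let K : Set (ℝ × ℝ) := (Icc 0 M ×ˢ Icc 0 M) ∩ {x : ℝ × ℝ | G x.1 x.2 ≤ 0 ∧ δ ≤ |x.1 - x.2|}
  have hK : IsCompact K := (isCompact_Icc.prod isCompact_Icc).inter_right
    ((isClosed_le h.cont continuous_const).inter (isClosed_le continuous_const (continuous_fst.sub continuous_snd).abs))
  have hne : K.Nonempty := by
    refine ⟨(p, q), ⟨⟨hp.1, le_max_left _ _⟩, hq.1, le_max_right _ _⟩, hc, ?_⟩
    by_contra! hd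
    exact absurd (near p q hpq hd) (not_lt.2 hc)
  obtain ⟨⟨s, t⟩, ⟨⟨hs, ht⟩, hle, hst⟩, hmin⟩ := hK.exists_isMinOn hne
    (f := fun x : ℝ × ℝ => max x.1 x.2) (by fun_prop)
  simp only at hs ht hle hst
  set τ := max s t with hτ
  have hτM : τ ≤ M := max_le hs.2 ht.2
  have hst' : s ≠ t := by rintro rfl; simp at hst; linarith
  have hτ0 : 0 < τ := by
    rcases lt_or_gt_of_ne hst' with hlt | hlt
    · exact lt_of_lt_of_le (lt_of_le_of_lt hs.1 hlt) (le_max_right _ _)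
    · exact lt_of_lt_of_le (lt_of_le_of_lt ht.1 hlt) (le_max_left _ _)
  have hdist : |s - t| < T := by
    rw [abs_lt]; constructor <;> linarith [hs.1, hs.2, ht.1, ht.2]
  have hin : ∀ u ∈ Ioo 0 τ, ∀ v ∈ Ioo 0 τ, u ≠ v → 0 < G u v := by
    intro u hu v hv huv
    by_contra! hc
    have hd : δ ≤ |u - v| := by
      by_contra! hd
      exact absurd (near u v huv hd) (not_lt.2 hc)
    have := hmin (show (u, v) ∈ K from
      ⟨⟨⟨hu.1.le, hu.2.le.trans hτM⟩, hv.1.le, hv.2.le.trans hτM⟩, hc, hd⟩)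
    exact absurd this (not_le.2 (max_lt hu.2 hv.2))
  have hdiag : ∀ u, 0 ≤ G u u := by
    intro u
    have h1 : Tendsto (fun v => G u v) (𝓝[>] u) (𝓝 (G u u)) :=
      (h.hasDerivAt_right u u).continuousAt.mono_left nhdsWithin_le_nhds
    refine ge_of_tendsto h1 ?_
    filter_upwards [Ioo_mem_nhdsGT (show u < u + δ by linarith)] with v hv
    refine (near u v hv.1.ne ?_).le
    rw [abs_sub_comm, abs_of_pos] <;> linarith [hv.1, hv.2]
  have hsq : ∀ u ∈ Icc 0 τ, ∀ v ∈ Icc 0 τ, 0 ≤ G u v := by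
    have hcl : IsClosed {x : ℝ × ℝ | 0 ≤ G x.1 x.2} := isClosed_le continuous_const h.cont
    have hsub : Ioo 0 τ ×ˢ Ioo 0 τ ⊆ {x : ℝ × ℝ | 0 ≤ G x.1 x.2} := by
      rintro ⟨u, v⟩ ⟨hu, hv⟩
      by_cases huv : u = v
      · subst huv; exact hdiag u
      · exact (hin u hu v hv huv).le
    have := closure_minimal hsub hcl
    rw [closure_prod_eq, closure_Ioo hτ0.ne] at this
    exact fun u hu v hv => this (show (u, v) ∈ _ from ⟨hu, hv⟩)
  have hsτ : s ∈ Icc 0 τ := ⟨hs.1, le_max_left _ _⟩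
  have htτ : t ∈ Icc 0 τ := ⟨ht.1, le_max_right _ _⟩
  have hzero : G s t = 0 := le_antisymm hle (hsq s hsτ t htτ)
  rcases lt_or_gt_of_ne hst' with hlt | hlt
  · have hτt : τ = t := max_eq_right hlt.le
    rcases eq_or_lt_of_le hs.1 with rfl | hpos
    · refine (h.reverse τ).end_ne_zero hτ0 (hτM.trans_lt hMT) (fun u hu v hv => hsq _ ?_ _ ?_) ?_
      · exact ⟨by linarith [hu.2], by linarith [hu.1]⟩
      · exact ⟨by linarith [hv.2], by linarith [hv.1]⟩
      · simpa [hτt] using hzero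
    · refine h.left_ne s t hst' hdist hzero ((h.hasDerivAt_left s t).eq_zero_of_le hpos hlt ?_)
      intro y hy
      rw [hzero]; exact hsq y ⟨hy.1.le, by linarith [hy.2]⟩ t htτ
  · have hτs : τ = s := max_eq_left hlt.le
    rcases eq_or_lt_of_le ht.1 with rfl | hpos
    · refine h.end_ne_zero hτ0 (hτM.trans_lt hMT) hsq ?_
      rw [hτs]; exact hzero
    · refine h.right_ne s t hst' hdist hzero ((h.hasDerivAt_right s t).eq_zero_of_le hpos hlt ?_)
      intro y hy
      rw [hzero]; exact hsq s hsτ y ⟨hy.1.le, by linarith [hy.2]⟩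

end TangentKernel

section QuadraticForms

lemma MvPolynomial.IsHomogeneous.exists_bilin {P : MvPolynomial (Fin 3) ℝ}
    (hP : P.IsHomogeneous 2) : ∃ b : (Fin 3 → ℝ) →ₗ[ℝ] (Fin 3 → ℝ) →ₗ[ℝ] ℝ,
      (∀ u v, b u v = b v u) ∧ ∀ p, eval p P = b p p := by
  classical
  have key : ∀ d : Fin 3 →₀ ℕ, ∀ c : ℝ, d.degree = 2 →
      ∃ b : (Fin 3 → ℝ) →ₗ[ℝ] (Fin 3 → ℝ) →ₗ[ℝ] ℝ,
        (∀ u v, b u v = b v u) ∧ ∀ p, eval p (monomial d c) = b p p := by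
    intro d c hd
    have hprod : ∀ i j : Fin 3, (∀ p : Fin 3 → ℝ, eval p (monomial d c) = c * (p i * p j)) →
        ∃ b : (Fin 3 → ℝ) →ₗ[ℝ] (Fin 3 → ℝ) →ₗ[ℝ] ℝ,
          (∀ u v, b u v = b v u) ∧ ∀ p, eval p (monomial d c) = b p p := by
      intro i j h
      refine ⟨LinearMap.mk₂ ℝ (fun u v => c / 2 * (u i * v j + u j * v i)) ?_ ?_ ?_ ?_, ?_, ?_⟩
      · intro u v w; simp only [Pi.add_apply]; ring
      · intro a u v; simp only [Pi.smul_apply, smul_eq_mul]; ring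
      · intro u v w; simp only [Pi.add_apply]; ring
      · intro a u v; simp only [Pi.smul_apply, smul_eq_mul]; ring
      · intro u v; simp only [LinearMap.mk₂_apply]; ring
      · intro p; rw [h p]; simp only [LinearMap.mk₂_apply]; ring
    have hev : ∀ p : Fin 3 → ℝ, eval p (monomial d c) = c * (p 0 ^ d 0 * p 1 ^ d 1 * p 2 ^ d 2) := by
      intro p
      rw [eval_monomial, Finsupp.prod_fintype _ _ (by simp), Fin.prod_univ_three]
    have hsum : d 0 + d 1 + d 2 = 2 := by
      have := Finsupp.degree_eq_sum d
      rw [Fin.sum_univ_three] at this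
      omega
    have h0 : d 0 ≤ 2 := by omega
    have h1 : d 1 ≤ 2 := by omega
    obtain ⟨i, j, hij⟩ : ∃ i j : Fin 3, ∀ p : Fin 3 → ℝ,
        p 0 ^ d 0 * p 1 ^ d 1 * p 2 ^ d 2 = p i * p j := by
      generalize d 0 = a at *
      generalize d 1 = b at *
      have h2 : d 2 = 2 - a - b := by omega
      rw [h2]
      interval_cases a <;> interval_cases b
      · exact ⟨2, 2, fun p => by ring⟩
      · exact ⟨1, 2, fun p => by ring⟩
      · exact ⟨1, 1, fun p => by ring⟩
      · exact ⟨0, 2, fun p => by ring⟩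
      · exact ⟨0, 1, fun p => by ring⟩
      · omega
      · exact ⟨0, 0, fun p => by ring⟩
      · omega
      · omega
    exact hprod i j fun p => by rw [hev, hij]
  rw [P.as_sum]
  have hsup : ∀ d ∈ P.support, d.degree = 2 := fun d hd => by
    have := hP (mem_support_iff.1 hd)
    exact (DFunLike.congr_fun Finsupp.degree_eq_weight_one d).trans this
  choose! b hb1 hb2 using fun d (hd : d ∈ P.support) => key d (coeff d P) (hsup d hd)
  refine ⟨∑ d ∈ P.support, b d, fun u v => ?_, fun p => ?_⟩
  · simp only [LinearMap.sum_apply]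
    exact Finset.sum_congr rfl fun d hd => hb1 d hd u v
  · simp only [LinearMap.sum_apply, map_sum]
    exact Finset.sum_congr rfl fun d hd => hb2 d hd p

lemma exists_continuous_bilin {P Q R : MvPolynomial (Fin 3) ℝ}
    (hP : P.IsHomogeneous 2) (hQ : Q.IsHomogeneous 2) (hR : R.IsHomogeneous 2) :
    ∃ B : (Fin 3 → ℝ) →L[ℝ] (Fin 3 → ℝ) →L[ℝ] (Fin 3 → ℝ),
      (∀ u v, B u v = B v u) ∧ ∀ p, Xf P Q R p = B p p := by
  obtain ⟨b₀, hb₀, e₀⟩ := hP.exists_bilin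
  obtain ⟨b₁, hb₁, e₁⟩ := hQ.exists_bilin
  obtain ⟨b₂, hb₂, e₂⟩ := hR.exists_bilin
  let B : (Fin 3 → ℝ) →ₗ[ℝ] (Fin 3 → ℝ) →ₗ[ℝ] (Fin 3 → ℝ) :=
    LinearMap.mk₂ ℝ (fun u v => ![b₀ u v, b₁ u v, b₂ u v]) (by simp) (by simp) (by simp) (by simp)
  refine ⟨LinearMap.toContinuousLinearMap
    ((LinearMap.toContinuousLinearMap : _ ≃ₗ[ℝ] ((Fin 3 → ℝ) →L[ℝ] (Fin 3 → ℝ))).toLinearMap ∘ₗ B),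
    fun u v => ?_, fun p => ?_⟩
  · simp [B, hb₀ u v, hb₁ u v, hb₂ u v]
  · simp [B, Xf, e₀, e₁, e₂]

end QuadraticForms

section TripleProduct

/-- The triple product `det (u, v, w)`. -/
def tri (u v w : Fin 3 → ℝ) : ℝ := dot3 (cross3 u v) w

lemma tri_def (u v w : Fin 3 → ℝ) : tri u v w = (u 1 * v 2 - u 2 * v 1) * w 0 +
    (u 2 * v 0 - u 0 * v 2) * w 1 + (u 0 * v 1 - u 1 * v 0) * w 2 := by
  simp [tri, dot3, cross3]

lemma exists_eq_add_of_tri_eq_zero {w x y r : Fin 3 → ℝ} (h : tri w x y ≠ 0)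
    (hr : tri w x r = 0) : ∃ α β : ℝ, r = α • w + β • x := by
  refine ⟨tri r x y / tri w x y, tri w r y / tri w x y, ?_⟩
  have key : ∀ i, tri w x y * r i = tri r x y * w i + tri w r y * x i + tri w x r * y i := by
    intro i; simp only [tri_def]; fin_cases i <;> simp <;> ring
  ext i
  have := key i
  rw [hr] at this
  simp only [Pi.add_apply, Pi.smul_apply, smul_eq_mul]
  field_simp
  linarith

lemma HasDerivAt.tri {u v w : ℝ → Fin 3 → ℝ} {u' v' w' : Fin 3 → ℝ} {t : ℝ}
    (hu : HasDerivAt u u' t) (hv : HasDerivAt v v' t) (hw : HasDerivAt w w' t) :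
    HasDerivAt (fun s => tri (u s) (v s) (w s))
      (tri u' (v t) (w t) + tri (u t) v' (w t) + tri (u t) (v t) w') t := by
  have hu := hasDerivAt_pi.1 hu
  have hv := hasDerivAt_pi.1 hv
  have hw := hasDerivAt_pi.1 hw
  simp only [tri_def]
  refine ((((((hu 1).mul (hv 2)).sub ((hu 2).mul (hv 1))).mul (hw 0)).add
    ((((hu 2).mul (hv 0)).sub ((hu 0).mul (hv 2))).mul (hw 1))).add
    ((((hu 0).mul (hv 1)).sub ((hu 1).mul (hv 0))).mul (hw 2))).congr_deriv ?_
  simp only [Pi.mul_apply, Pi.sub_apply]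
  ring

lemma Continuous.tri {α : Type*} [TopologicalSpace α] {u v w : α → Fin 3 → ℝ}
    (hu : Continuous u) (hv : Continuous v) (hw : Continuous w) :
    Continuous fun a => tri (u a) (v a) (w a) := by
  simp only [tri_def]
  fun_prop

end TripleProduct

section Algebra

variable {B : (Fin 3 → ℝ) →L[ℝ] (Fin 3 → ℝ) →L[ℝ] (Fin 3 → ℝ)}

lemma bilin_comb (hB : ∀ u v, B u v = B v u) (w x : Fin 3 → ℝ) (α β ρ σ : ℝ) :
    B (α • w + β • x) (ρ • w + σ • x) =
      (α * ρ) • B w w + (α * σ + β * ρ) • B w x + (β * σ) • B x x := by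
  simp only [map_add, map_smul, add_apply, smul_apply,
    hB x w]
  module

/-- Half of the geodesic curvature (up to a positive factor) of the orbit through `p`. -/
noncomputable def halfCurv (B : (Fin 3 → ℝ) →L[ℝ] (Fin 3 → ℝ) →L[ℝ] (Fin 3 → ℝ)) (p : Fin 3 → ℝ) : ℝ :=
  tri p (B p p) (B p (B p p))

lemma tri_left_comb (w : Fin 3 → ℝ) (α β : ℝ) :
    tri w (B w (B w w)) (α • w + β • B w w) = -(β * halfCurv B w) := by
  simp only [halfCurv, tri_def, Pi.add_apply, Pi.smul_apply, smul_eq_mul]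
  ring

lemma tri_right_comb (hB : ∀ u v, B u v = B v u) (w : Fin 3 → ℝ) (α β : ℝ) :
    tri w (B w w) (B (α • w + β • B w w) (α • w + β • B w w)) =
      β * (2 * α * halfCurv B w + β * tri w (B w w) (B (B w w) (B w w))) := by
  rw [bilin_comb hB]
  simp only [halfCurv, tri_def, Pi.add_apply, Pi.smul_apply, smul_eq_mul]
  ring

lemma tri_comb_comb (hB : ∀ u v, B u v = B v u) (w : Fin 3 → ℝ) (α β ρ σ : ℝ) :
    tri (α • w + β • B w w) (B (α • w + β • B w w) (α • w + β • B w w)) (ρ • w + σ • B w w) =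
      (β * ρ - α * σ) *
        (β * (2 * α * halfCurv B w + β * tri w (B w w) (B (B w w) (B w w)))) := by
  rw [bilin_comb hB]
  simp only [halfCurv, tri_def, Pi.add_apply, Pi.smul_apply, smul_eq_mul]
  ring

lemma exists_comb_of_tri_eq_zero {w r : Fin 3 → ℝ} (hw : halfCurv B w ≠ 0)
    (hr : tri w (B w w) r = 0) : ∃ α β : ℝ, r = α • w + β • B w w :=
  exists_eq_add_of_tri_eq_zero hw hr

/-- There are no bitangents at points where the curvatures have the same sign. -/
lemma halfCurv_mul_nonpos (hB : ∀ u v, B u v = B v u) {w : Fin 3 → ℝ} {α β : ℝ} (hβ : β ≠ 0)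
    (hw : halfCurv B w ≠ 0)
    (h : tri w (B w w) (B (α • w + β • B w w) (α • w + β • B w w)) = 0) :
    halfCurv B w * halfCurv B (α • w + β • B w w) ≤ 0 := by
  obtain ⟨ρ, σ, e⟩ := exists_comb_of_tri_eq_zero hw h
  have hm := h
  rw [tri_right_comb hB] at hm
  have hm := (mul_eq_zero.1 hm).resolve_left hβ
  have key : halfCurv B (α • w + β • B w w) = -((α * σ - β * ρ) ^ 2 * halfCurv B w) := by
    rw [halfCurv, e, bilin_comb hB]
    have : tri (α • w + β • B w w) (ρ • w + σ • B w w) ((α * ρ) • B w w +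
        (α * σ + β * ρ) • B w (B w w) + (β * σ) • B (B w w) (B w w)) = (α * σ - β * ρ) *
        ((α * σ + β * ρ) * halfCurv B w + β * σ * tri w (B w w) (B (B w w) (B w w))) := by
      simp only [halfCurv, tri_def, Pi.add_apply, Pi.smul_apply, smul_eq_mul]
      ring
    rw [this]
    linear_combination (α * σ - β * ρ) * σ * hm
  rw [key]
  nlinarith [mul_nonneg (sq_nonneg (α * σ - β * ρ)) (sq_nonneg (halfCurv B w))]

end Algebra

section Orbits

variable {B : (Fin 3 → ℝ) →L[ℝ] (Fin 3 → ℝ) →L[ℝ] (Fin 3 → ℝ)}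

lemma isCompact_S2 : IsCompact S2 := by
  refine Metric.isCompact_of_isClosed_isBounded ?_ ?_
  · exact isClosed_eq (by fun_prop) continuous_const
  · refine (Metric.isBounded_closedBall (x := (0 : Fin 3 → ℝ)) (r := 1)).subset fun p hp => ?_
    have hp : p 0 ^ 2 + p 1 ^ 2 + p 2 ^ 2 = 1 := hp
    rw [mem_closedBall_zero_iff, pi_norm_le_iff_of_nonneg zero_le_one]
    intro i
    rw [Real.norm_eq_abs, abs_le_one_iff_mul_self_le_one]
    fin_cases i <;> simp <;> nlinarith [sq_nonneg (p 0), sq_nonneg (p 1), sq_nonneg (p 2)]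

lemma orbit_unique {f g : ℝ → Fin 3 → ℝ} (hf : ∀ t, HasDerivAt f (B (f t) (f t)) t)
    (hg : ∀ t, HasDerivAt g (B (g t) (g t)) t) (hfS : ∀ t, f t ∈ S2) (hgS : ∀ t, g t ∈ S2)
    {t₀ : ℝ} (h : f t₀ = g t₀) : f = g := by
  have hc : ContDiff ℝ 1 fun p => B p p := by fun_prop
  obtain ⟨K, hK⟩ := hc.locallyLipschitz.locallyLipschitzOn.exists_lipschitzOnWith_of_compact
    isCompact_S2
  exact ODE_solution_unique_univ (v := fun _ p => B p p) (s := fun _ => S2) (fun _ => hK)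
    (fun t => ⟨hf t, hfS t⟩) (fun t => ⟨hg t, hgS t⟩) h

lemma zero_notMem_S2 : (0 : Fin 3 → ℝ) ∉ S2 := by simp [S2]

lemma neg_mem_S2 {p : Fin 3 → ℝ} (hp : p ∈ S2) : -p ∈ S2 := by
  simpa [S2] using hp

variable {γ : ℝ → Fin 3 → ℝ}

lemma hasDerivAt_velocity (hB : ∀ u v, B u v = B v u)
    (hγ : ∀ t, HasDerivAt γ (B (γ t) (γ t)) t) (t : ℝ) :
    HasDerivAt (fun s => B (γ s) (γ s)) ((2 : ℝ) • B (γ t) (B (γ t) (γ t))) t := by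
  have := B.hasDerivAt_of_bilinear (fun _ => hγ t) (fun _ => hγ t)
  rwa [hB (B (γ t) (γ t)), ← two_smul ℝ] at this

lemma orbit_add_eq (hγ : ∀ t, HasDerivAt γ (B (γ t) (γ t)) t) (hS : ∀ t, γ t ∈ S2) {s t : ℝ}
    (h : γ s = γ t) (u : ℝ) : γ (u + (s - t)) = γ u := by
  have := orbit_unique (f := fun u => γ (u + (s - t))) (g := γ)
    (fun u => (hγ (u + (s - t))).comp_add_const u (s - t)) hγ (fun _ => hS _) hS (t₀ := t)
    (by simpa using h)
  exact congrFun this u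

lemma orbit_ne_neg (hγ : ∀ t, HasDerivAt γ (B (γ t) (γ t)) t) (hS : ∀ t, γ t ∈ S2) (s t : ℝ) :
    γ s ≠ -γ t := by
  intro h
  have := orbit_unique (f := fun u => -γ (t + s - u)) (g := γ)
    (fun u => by simpa using ((hγ (t + s - u)).comp_const_sub (t + s) u).fun_neg) hγ
    (fun _ => neg_mem_S2 (hS _)) hS (t₀ := s) (by simpa using h.symm)
  have h2 := congrFun this ((t + s) / 2)
  simp only [show t + s - (t + s) / 2 = (t + s) / 2 by ring] at h2
  have h3 : γ ((t + s) / 2) = 0 := self_eq_neg.1 h2.symm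
  exact zero_notMem_S2 (h3 ▸ hS ((t + s) / 2))

lemma velocity_ne_zero (hγ : ∀ t, HasDerivAt γ (B (γ t) (γ t)) t) (hS : ∀ t, γ t ∈ S2)
    (hne : ¬ ∀ t, γ t = γ 0) (s : ℝ) : B (γ s) (γ s) ≠ 0 := by
  intro h
  have := orbit_unique (f := fun _ => γ s) (g := γ)
    (fun u => by simpa [h] using hasDerivAt_const u (γ s)) hγ (fun _ => hS _) hS (t₀ := s) rfl
  exact hne fun t => by rw [← congrFun this t, ← congrFun this 0]

lemma exists_minimal_period (hγ : ∀ t, HasDerivAt γ (B (γ t) (γ t)) t) (hS : ∀ t, γ t ∈ S2)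
    (hne : ¬ ∀ t, γ t = γ 0) {T : ℝ} (hT : 0 < T) (hper : ∀ t, γ (t + T) = γ t) :
    ∃ T₀ > 0, Function.Periodic γ T₀ ∧ ∀ s t, |s - t| < T₀ → γ s = γ t → s = t := by
  have hcont : Continuous γ := continuous_iff_continuousAt.2 fun t => (hγ t).continuousAt
  let H : AddSubgroup ℝ :=
    { carrier := {c | ∀ t, γ (t + c) = γ t}
      zero_mem' := by simp
      add_mem' := fun {a b} ha hb t => by rw [← add_assoc, hb, ha]
      neg_mem' := fun {a} ha t => by rw [← ha (t + -a)]; simp }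
  rcases H.dense_or_cyclic with hd | ⟨a, ha⟩
  · refine absurd (fun t => ?_) hne
    have hcl : IsClosed {c : ℝ | γ c = γ 0} := isClosed_eq hcont continuous_const
    have hsub : (H : Set ℝ) ⊆ {c : ℝ | γ c = γ 0} := fun c hc => by simpa using hc 0
    exact closure_minimal hsub hcl (hd t)
  · rw [← AddSubgroup.zmultiples_eq_closure] at ha
    have haH : a ∈ H := ha ▸ AddSubgroup.mem_zmultiples a
    have ha0 : a ≠ 0 := by
      rintro rfl
      have : T ∈ H := hper
      simp [ha] at this
      exact hT.ne' this
    refine ⟨|a|, abs_pos.2 ha0, ?_, fun s t hst h => ?_⟩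
    · rcases abs_choice a with h | h <;> rw [h]
      · exact haH
      · exact H.neg_mem haH
    · have hmem : s - t ∈ H := fun u => orbit_add_eq hγ hS h u
      rw [ha] at hmem
      obtain ⟨k, hk⟩ := AddSubgroup.mem_zmultiples_iff.1 hmem
      rw [← hk, zsmul_eq_mul, abs_mul, ← Int.cast_abs] at hst
      have h1 : (|k| : ℤ) < (1 : ℝ) := by
        by_contra! hc
        nlinarith [abs_pos.2 ha0]
      have h2 : |k| < 1 := by exact_mod_cast h1
      rw [Int.abs_lt_one_iff.1 h2] at hk
      simp at hk
      linarith

end Orbits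

section Kernel

lemma pos_of_deriv2_pos {g g' g'' : ℝ → ℝ} {s t δ : ℝ} (h1 : ∀ u, HasDerivAt g (g' u) u)
    (h2 : ∀ u, HasDerivAt g' (g'' u) u) (h3 : ∀ u, |u - s| < δ → 0 < g'' u) (hg : g s = 0)
    (hg' : g' s = 0) (hst : t ≠ s) (ht : |t - s| < δ) : 0 < g t := by
  have c1 : Continuous g := continuous_iff_continuousAt.2 fun u => (h1 u).continuousAt
  have c2 : Continuous g' := continuous_iff_continuousAt.2 fun u => (h2 u).continuousAt
  rw [abs_lt] at ht
  rcases lt_or_gt_of_ne hst with h | h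
  · obtain ⟨c, hc, ec⟩ := exists_hasDerivAt_eq_slope g g' h c1.continuousOn fun u _ => h1 u
    obtain ⟨d, hd, ed⟩ := exists_hasDerivAt_eq_slope g' g'' hc.2 c2.continuousOn fun u _ => h2 u
    have hpos := h3 d (abs_lt.2 ⟨by linarith [hd.1, hc.1], by linarith [hd.2]⟩)
    rw [eq_div_iff (by linarith [hc.2])] at ed
    rw [eq_div_iff (by linarith)] at ec
    have := mul_pos hpos (sub_pos.2 hc.2)
    nlinarith [mul_pos (show 0 < -g' c by linarith) (sub_pos.2 h)]
  · obtain ⟨c, hc, ec⟩ := exists_hasDerivAt_eq_slope g g' h c1.continuousOn fun u _ => h1 u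
    obtain ⟨d, hd, ed⟩ := exists_hasDerivAt_eq_slope g' g'' hc.1 c2.continuousOn fun u _ => h2 u
    have hpos := h3 d (abs_lt.2 ⟨by linarith [hd.1], by linarith [hd.2, hc.2]⟩)
    rw [eq_div_iff (by linarith [hc.1])] at ed
    rw [eq_div_iff (by linarith)] at ec
    have := mul_pos hpos (sub_pos.2 hc.1)
    nlinarith [mul_pos (show 0 < g' c by linarith) (sub_pos.2 h)]

variable {B : (Fin 3 → ℝ) →L[ℝ] (Fin 3 → ℝ) →L[ℝ] (Fin 3 → ℝ)} {γ : ℝ → Fin 3 → ℝ}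

lemma exists_near_pos (hB : ∀ u v, B u v = B v u) (hγ : ∀ t, HasDerivAt γ (B (γ t) (γ t)) t)
    {T ε : ℝ} (hT : 0 < T) (hper : Function.Periodic γ T) (hκ : ∀ s, 0 < ε * halfCurv B (γ s)) :
    ∃ δ > 0, ∀ s t, s ≠ t → |s - t| < δ → 0 < ε * tri (γ s) (B (γ s) (γ s)) (γ t) := by
  have hcont : Continuous γ := continuous_iff_continuousAt.2 fun t => (hγ t).continuousAt
  let H : ℝ → ℝ → ℝ := fun s r => ε * tri (γ s) (B (γ s) (γ s))
    ((2 : ℝ) • B (γ (s + r)) (B (γ (s + r)) (γ (s + r))))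
  have hH : Continuous fun x : ℝ × ℝ => H x.1 x.2 :=
    continuous_const.mul (Continuous.tri (by fun_prop) (by fun_prop) (by fun_prop))
  have hHper : Function.Periodic H T := by
    intro s
    funext r
    simp only [H, hper s, show s + T + r = s + r + T by ring, hper (s + r)]
  have hH0 : ∀ s, 0 < H s 0 := by
    intro s
    have : H s 0 = 2 * (ε * halfCurv B (γ s)) := by
      simp only [H, add_zero, halfCurv, tri_def, Pi.smul_apply, smul_eq_mul]; ring
    rw [this]; linarith [hκ s]
  obtain ⟨U, V, -, hV, hU, h0V, hUV⟩ := generalized_tube_lemma (isCompact_Icc (a := 0) (b := T))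
    (isCompact_singleton (x := (0 : ℝ))) (isOpen_lt continuous_const hH)
    (by rintro ⟨s, r⟩ ⟨-, hr⟩; obtain rfl : r = 0 := hr; exact hH0 s)
  obtain ⟨δ, hδ, hball⟩ := Metric.isOpen_iff.1 hV 0 (h0V rfl)
  refine ⟨δ, hδ, fun s t hst hd => ?_⟩
  have hpos : ∀ r, |r| < δ → 0 < H s r := by
    intro r hr
    obtain ⟨s', hs', e⟩ := hHper.exists_mem_Ico₀ hT s
    rw [e]
    exact hUV (show (s', r) ∈ U ×ˢ V from
      ⟨hU ⟨hs'.1, hs'.2.le⟩, hball (by simpa [Metric.mem_ball, Real.dist_eq] using hr)⟩)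
  refine pos_of_deriv2_pos (s := s) (t := t) (δ := δ)
    (g := fun u => ε * tri (γ s) (B (γ s) (γ s)) (γ u))
    (g' := fun u => ε * tri (γ s) (B (γ s) (γ s)) (B (γ u) (γ u)))
    (g'' := fun u => ε * tri (γ s) (B (γ s) (γ s)) ((2 : ℝ) • B (γ u) (B (γ u) (γ u))))
    (fun u => ?_) (fun u => ?_) (fun u hu => ?_) ?_ ?_ hst.symm (by rwa [abs_sub_comm])
  · refine (((hasDerivAt_const u _).tri (hasDerivAt_const u _) (hγ u)).const_mul ε).congr_deriv ?_
    simp [tri_def]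
  · refine (((hasDerivAt_const u _).tri (hasDerivAt_const u _)
      (hasDerivAt_velocity hB hγ u)).const_mul ε).congr_deriv ?_
    simp [tri_def]
  · have := hpos (u - s) hu
    simpa only [H, add_sub_cancel] using this
  · simp only [tri_def]; ring
  · simp only [tri_def]; ring

lemma ne_zero_of_comb_mem {w : Fin 3 → ℝ} {α β : ℝ} {x : Fin 3 → ℝ} (hw : w ∈ S2)
    (hr : α • w + β • x ∈ S2) (h1 : α • w + β • x ≠ w) (h2 : α • w + β • x ≠ -w) : β ≠ 0 := by
  rintro rfl
  simp only [zero_smul, add_zero] at *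
  have e1 : w 0 ^ 2 + w 1 ^ 2 + w 2 ^ 2 = 1 := hw
  have e2 : (α * w 0) ^ 2 + (α * w 1) ^ 2 + (α * w 2) ^ 2 = 1 := hr
  have e3 : α ^ 2 = 1 := by linear_combination e2 - α ^ 2 * e1
  rcases mul_self_eq_one_iff.1 ((sq α).symm.trans e3) with rfl | rfl
  · exact h1 (one_smul _ _)
  · exact h2 (by simp)

lemma neg_of_collinear_comb {ε k m α β ρ σ : ℝ} (hk : 0 < ε * k)
    (h1 : 0 < ε * (2 * -(β * k)) * (ε * (2 * -(σ * k))))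
    (h2 : ε * (2 * -(β * k)) * (ε * (β * (2 * α * k + β * m))) < 0)
    (h3 : 0 ≤ ε * ((β * ρ - α * σ) * (β * (2 * α * k + β * m)))) :
    ε * (2 * -(σ * k)) * (ε * (σ * (2 * ρ * k + σ * m))) < 0 := by
  have hβσ : 0 < β * σ := by
    refine pos_of_mul_pos_right (a := 4 * (ε * k) ^ 2) ?_ (by positivity)
    linear_combination h1
  have hA : 0 < ε * (2 * α * k + β * m) := by
    refine pos_of_mul_pos_right (a := 2 * (ε * k) * β ^ 2) ?_ (by positivity)
    linear_combination h2
  have hD : 0 ≤ β * (β * ρ - α * σ) := by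
    refine nonneg_of_mul_nonneg_right (a := ε * (2 * α * k + β * m)) ?_ hA
    linear_combination h3
  have hC : 0 < ε * (2 * ρ * k + σ * m) := by
    refine pos_of_mul_pos_right (a := β ^ 2) ?_ (by positivity)
    have : 0 < β * σ * (ε * (2 * α * k + β * m)) + 2 * (ε * k) * (β * (β * ρ - α * σ)) := by
      positivity
    linear_combination this
  have hσ : σ ≠ 0 := right_ne_zero_of_mul hβσ.ne'
  have : 0 < 2 * (ε * k) * σ ^ 2 * (ε * (2 * ρ * k + σ * m)) := by positivity
  linear_combination this

lemma tangentKernel_of_curv_pos (hB : ∀ u v, B u v = B v u)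
    (hγ : ∀ t, HasDerivAt γ (B (γ t) (γ t)) t) (hS : ∀ t, γ t ∈ S2)
    {T ε : ℝ} (hT : 0 < T) (hper : Function.Periodic γ T)
    (hinj : ∀ s t, |s - t| < T → γ s = γ t → s = t)
    (hκ : ∀ s, 0 < ε * halfCurv B (γ s)) :
    TangentKernel T (fun s t => ε * tri (γ s) (B (γ s) (γ s)) (γ t))
      (fun s t => ε * (2 * tri (γ s) (B (γ s) (B (γ s) (γ s))) (γ t)))
      (fun s t => ε * tri (γ s) (B (γ s) (γ s)) (B (γ t) (γ t)))
      (fun s => 2 * (ε * halfCurv B (γ s))) := by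
  have hcont : Continuous γ := continuous_iff_continuousAt.2 fun t => (hγ t).continuousAt
  have hε : ε ≠ 0 := by rintro rfl; simpa using hκ 0
  have hh : ∀ s, halfCurv B (γ s) ≠ 0 := fun s h => by simpa [h] using hκ s
  have comb : ∀ s t, ε * tri (γ s) (B (γ s) (γ s)) (γ t) = 0 →
      ∃ α β : ℝ, γ t = α • γ s + β • B (γ s) (γ s) := fun s t h =>
    exists_comb_of_tri_eq_zero (hh s) ((mul_eq_zero.1 h).resolve_left hε)
  have beta_ne : ∀ s t, s ≠ t → |s - t| < T → ∀ α β : ℝ,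
      γ t = α • γ s + β • B (γ s) (γ s) → β ≠ 0 := by
    intro s t hst hd α β e
    refine ne_zero_of_comb_mem (hS s) (e ▸ hS t) (e ▸ fun h => hst (hinj s t hd h.symm))
      (e ▸ orbit_ne_neg hγ hS t s)
  have right_ne : ∀ s t, s ≠ t → |s - t| < T → ε * tri (γ s) (B (γ s) (γ s)) (γ t) = 0 →
      tri (γ s) (B (γ s) (γ s)) (B (γ t) (γ t)) ≠ 0 := by
    intro s t hst hd h h'
    obtain ⟨α, β, e⟩ := comb s t h
    have hβ := beta_ne s t hst hd α β e
    rw [e] at h'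
    have := halfCurv_mul_nonpos hB hβ (hh s) h'
    rw [← e] at this
    have h1 := mul_pos (hκ s) (hκ t)
    nlinarith [mul_nonneg (sq_nonneg ε) (neg_nonneg.2 this)]
  refine ⟨?_, fun s t => ?_, fun s t => ?_, fun s t => ?_, fun s => ?_, ?_, ?_, ?_, ?_, ?_, ?_⟩
  · exact continuous_const.mul (Continuous.tri (by fun_prop) (by fun_prop) (by fun_prop))
  · refine (((hγ s).tri (hasDerivAt_velocity hB hγ s)
      (hasDerivAt_const s (γ t))).const_mul ε).congr_deriv ?_
    simp only [tri_def, Pi.smul_apply, smul_eq_mul, Pi.zero_apply]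
    ring
  · refine (((hasDerivAt_const t _).tri (hasDerivAt_const t _) (hγ t)).const_mul ε).congr_deriv ?_
    simp [tri_def]
  · rw [hper t]
  · linarith [hκ s]
  · exact exists_near_pos hB hγ hT hper hκ
  · intro s t hst hd h
    obtain ⟨α, β, e⟩ := comb s t h
    have hβ := beta_ne s t hst hd α β e
    rw [e, tri_left_comb]
    simp [hε, hβ, hh s]
  · exact fun s t hst hd h => mul_ne_zero hε (right_ne s t hst hd h)
  · intro s t hst hd h h'
    obtain ⟨α, β, e⟩ := comb s t h
    have hβ := beta_ne s t hst hd α β e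
    refine right_ne s t hst hd h ?_
    have h'' := (mul_eq_zero.1 h').resolve_left hε
    have e' := tri_comb_comb hB (γ s) α β 1 0
    rw [one_smul, zero_smul, add_zero] at e'
    rw [e] at h'' ⊢
    rw [e'] at h''
    rw [tri_right_comb hB]
    simpa [hβ] using h''
  · intro s a b ha hb h1 h2 h3
    obtain ⟨α, β, ea⟩ := comb s a ha
    obtain ⟨ρ, σ, eb⟩ := comb s b hb
    rw [ea, eb] at h1
    rw [ea] at h2
    rw [ea, eb] at h3
    rw [eb]
    rw [tri_comb_comb hB] at h3
    rw [tri_right_comb hB] at h2 ⊢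
    rw [tri_left_comb] at h1 h2 ⊢
    rw [tri_left_comb] at h1
    exact neg_of_collinear_comb (hκ s) h1 h2 h3
  · intro a s b ha hb
    obtain ⟨ρ, σ, eb⟩ := comb s b hb
    have h0 := (mul_eq_zero.1 ha).resolve_left hε
    rw [eb, tri_left_comb]
    have : tri (γ a) (B (γ a) (γ a)) (ρ • γ s + σ • B (γ s) (γ s)) =
        ρ * tri (γ a) (B (γ a) (γ a)) (γ s) + σ * tri (γ a) (B (γ a) (γ a)) (B (γ s) (γ s)) := by
      simp only [tri_def, Pi.add_apply, Pi.smul_apply, smul_eq_mul]; ring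
    rw [this, h0]
    ring

end Kernel

section Inflection

/-- A periodic solution of `f' = c * g ^ 2 + l * f` with a zero vanishes identically. -/
lemma eq_zero_of_periodic_of_hasDerivAt {f g l : ℝ → ℝ} {c T a : ℝ} (hl : Continuous l)
    (hf : ∀ t, HasDerivAt f (c * g t ^ 2 + l t * f t) t) (hT : 0 < T)
    (hper : Function.Periodic f T) (ha : f a = 0) (t : ℝ) : f t = 0 := by
  wlog hc : 0 ≤ c generalizing f c
  · have := this (f := fun t => -f t) (c := -c)
      (fun t => (hf t).fun_neg.congr_deriv (by ring)) (fun t => by simp only [hper t])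
      (by simp [ha]) (by linarith)
    simpa using this
  let L : ℝ → ℝ := fun t => ∫ s in a..t, l s
  have hL : ∀ t, HasDerivAt L (l t) t := fun t =>
    intervalIntegral.integral_hasDerivAt_right (hl.intervalIntegrable _ _)
      (hl.stronglyMeasurableAtFilter _ _) hl.continuousAt
  let F : ℝ → ℝ := fun t => f t * Real.exp (-L t)
  have hF : ∀ t, HasDerivAt F (c * g t ^ 2 * Real.exp (-L t)) t := fun t =>
    ((hf t).mul (hL t).fun_neg.exp).congr_deriv (by ring)
  have hmono : Monotone F := monotone_of_hasDerivAt_nonneg hF fun t => by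
    simp only [Pi.zero_apply]; positivity
  obtain ⟨u, hu, e⟩ := hper.exists_mem_Ico hT t a
  have h1 := hmono hu.1
  have h2 := hmono hu.2.le
  simp only [F, hper a, ha, zero_mul] at h1 h2
  rw [e]
  exact (mul_eq_zero.1 (le_antisymm h2 h1)).resolve_right (Real.exp_ne_zero _)

variable {B : (Fin 3 → ℝ) →L[ℝ] (Fin 3 → ℝ) →L[ℝ] (Fin 3 → ℝ)} {γ : ℝ → Fin 3 → ℝ}

lemma tri_cross3_ne_zero {w x : Fin 3 → ℝ} (hw : w ∈ S2) (hx : x ≠ 0) (h : dot3 w x = 0) :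
    tri w x (cross3 w x) ≠ 0 := by
  intro h0
  have hw : w 0 ^ 2 + w 1 ^ 2 + w 2 ^ 2 = 1 := hw
  have e : x 0 ^ 2 + x 1 ^ 2 + x 2 ^ 2 = 0 := by
    simp only [tri_def, cross3, Matrix.cons_val_zero, Matrix.cons_val_one, Matrix.cons_val] at h0
    simp only [dot3] at h
    linear_combination h0 + (w 0 * x 0 + w 1 * x 1 + w 2 * x 2) * h
      - (x 0 ^ 2 + x 1 ^ 2 + x 2 ^ 2) * hw
  refine hx (funext fun i => ?_)
  fin_cases i <;> simp <;> nlinarith [sq_nonneg (x 0), sq_nonneg (x 1), sq_nonneg (x 2)]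

lemma tri_eq_zero_of_coplanar {w x n a b c : Fin 3 → ℝ} (hn : tri w x n ≠ 0)
    (ha : tri w x a = 0) (hb : tri w x b = 0) (hc : tri w x c = 0) : tri a b c = 0 := by
  obtain ⟨_, _, rfl⟩ := exists_eq_add_of_tri_eq_zero hn ha
  obtain ⟨_, _, rfl⟩ := exists_eq_add_of_tri_eq_zero hn hb
  obtain ⟨_, _, rfl⟩ := exists_eq_add_of_tri_eq_zero hn hc
  simp only [tri_def, Pi.add_apply, Pi.smul_apply, smul_eq_mul]
  ring

/-- A periodic orbit with an inflection point is contained in its tangent plane there. -/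
lemma tri_eq_zero_of_halfCurv_eq_zero (hB : ∀ u v, B u v = B v u)
    (hγ : ∀ t, HasDerivAt γ (B (γ t) (γ t)) t) {T a : ℝ} (hT : 0 < T)
    (hper : Function.Periodic γ T) {n : Fin 3 → ℝ}
    (hn : tri (γ a) (B (γ a) (γ a)) n ≠ 0) (hκ : halfCurv B (γ a) = 0) (t : ℝ) :
    tri (γ a) (B (γ a) (γ a)) (γ t) = 0 := by
  have hcont : Continuous γ := continuous_iff_continuousAt.2 fun t => (hγ t).continuousAt
  set w := γ a
  set x := B w w with hx
  let α : ℝ → ℝ := fun t => tri (γ t) x n / tri w x n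
  let β : ℝ → ℝ := fun t => tri w (γ t) n / tri w x n
  let φ : ℝ → ℝ := fun t => tri w x (γ t) / tri w x n
  have hα : Continuous α := (hcont.tri continuous_const continuous_const).div_const _
  have hβ : Continuous β := (continuous_const.tri hcont continuous_const).div_const _
  have hφ : Continuous φ := (continuous_const.tri continuous_const hcont).div_const _
  have hdec : ∀ t, γ t = α t • w + β t • x + φ t • n := by
    intro t
    ext i
    simp only [α, β, φ, Pi.add_apply, Pi.smul_apply, smul_eq_mul]
    field_simp
    simp only [tri_def]
    fin_cases i <;> simp <;> ring
  let l : ℝ → ℝ := fun t => (2 * tri w x (B (α t • w + β t • x) n) + φ t * tri w x (B n n)) /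
    tri w x n
  have hl : Continuous l := by
    refine ((continuous_const.mul (continuous_const.tri continuous_const ?_)).add
      (hφ.mul continuous_const)).div_const _
    fun_prop
  refine eq_zero_of_periodic_of_hasDerivAt (f := fun t => tri w x (γ t)) (g := β) (l := l)
    (c := tri w x (B x x)) (a := a) hl (fun t => ?_) hT (fun t => by simp only [hper t]) ?_ t
  · refine ((hasDerivAt_const t w).tri (hasDerivAt_const t x) (hγ t)).congr_deriv ?_
    have e1 : B (γ t) (γ t) = (α t * α t) • x + (α t * β t + β t * α t) • B w x +
        (β t * β t) • B x x + (2 * φ t) • B (α t • w + β t • x) n + (φ t * φ t) • B n n := by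
      rw [hx, ← bilin_comb hB, ← hx]
      conv_lhs => rw [hdec t]
      generalize α t • w + β t • x = u
      simp only [map_add, map_smul, add_apply, smul_apply, hB n u]
      module
    have e2 : φ t * tri w x n = tri w x (γ t) := div_mul_cancel₀ _ hn
    have e3 : l t * tri w x (γ t) =
        φ t * (2 * tri w x (B (α t • w + β t • x) n) + φ t * tri w x (B n n)) := by
      simp only [l, φ]; ring
    have lin : ∀ (c₁ c₂ c₃ c₄ c₅ : ℝ) (v₁ v₂ v₃ v₄ v₅ : Fin 3 → ℝ),
        tri w x (c₁ • v₁ + c₂ • v₂ + c₃ • v₃ + c₄ • v₄ + c₅ • v₅) = c₁ * tri w x v₁ +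
          c₂ * tri w x v₂ + c₃ * tri w x v₃ + c₄ * tri w x v₄ + c₅ * tri w x v₅ := by
      intros; simp only [tri_def, Pi.add_apply, Pi.smul_apply, smul_eq_mul]; ring
    have z1 : tri w x x = 0 := by simp only [tri_def]; ring
    have z2 : tri w x (B w x) = 0 := hκ
    have z3 : tri 0 x (γ t) = 0 := by simp [tri_def]
    have z4 : tri w 0 (γ t) = 0 := by simp [tri_def]
    rw [e3, e1, lin, z1, z2, z3, z4]
    ring
  · simp only [tri_def, w]; ring

end Inflection

section Convexity

variable {B : (Fin 3 → ℝ) →L[ℝ] (Fin 3 → ℝ) →L[ℝ] (Fin 3 → ℝ)} {γ : ℝ → Fin 3 → ℝ}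

lemma eq_of_tri_eq_zero_of_curv_pos (hB : ∀ u v, B u v = B v u)
    (hγ : ∀ t, HasDerivAt γ (B (γ t) (γ t)) t) (hS : ∀ t, γ t ∈ S2)
    {T ε : ℝ} (hT : 0 < T) (hper : Function.Periodic γ T)
    (hinj : ∀ s t, |s - t| < T → γ s = γ t → s = t)
    (hκ : ∀ s, 0 < ε * halfCurv B (γ s)) {s t : ℝ}
    (h : tri (γ s) (B (γ s) (γ s)) (γ t) = 0) : γ t = γ s := by
  have K := tangentKernel_of_curv_pos (γ := fun u => γ (u + s)) hB
    (fun u => (hγ (u + s)).comp_add_const u s) (fun u => hS _) hT (hper.add_const s)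
    (fun u v huv e => by simpa using hinj (u + s) (v + s) (by simpa using huv) e) (fun u => hκ _)
  obtain ⟨u, hu, e⟩ := (hper.add_const s).exists_mem_Ico₀ hT (t - s)
  simp only [sub_add_cancel] at e
  rcases eq_or_ne 0 u with rfl | hu0
  · simpa using e
  · have := K.pos_of_mem_Ico ⟨le_rfl, hT⟩ hu hu0
    simp only [zero_add, ← e, h, mul_zero, lt_irrefl] at this

lemma orbit_convex (hB : ∀ u v, B u v = B v u) (htan : ∀ p ∈ S2, dot3 p (B p p) = 0)
    (hγ : ∀ t, HasDerivAt γ (B (γ t) (γ t)) t) (hS : ∀ t, γ t ∈ S2)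
    (hne : ¬ ∀ t, γ t = γ 0) {T : ℝ} (hT : 0 < T) (hper : Function.Periodic γ T) (s : ℝ) :
    (∀ t, tri (γ s) (B (γ s) (γ s)) (γ t) = 0 → γ t = γ s) ∨
      ∀ t, tri (γ s) (B (γ s) (γ s)) (γ t) = 0 := by
  by_cases hz : ∃ a, halfCurv B (γ a) = 0
  · right
    intro t
    obtain ⟨a, ha⟩ := hz
    have hn := tri_cross3_ne_zero (hS a) (velocity_ne_zero hγ hS hne a) (htan _ (hS a))
    have h0 := tri_eq_zero_of_halfCurv_eq_zero hB hγ hT hper hn ha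
    refine tri_eq_zero_of_coplanar hn (h0 s) ?_ (h0 t)
    have h1 := (hasDerivAt_const s (γ a)).tri (hasDerivAt_const s (B (γ a) (γ a))) (hγ s)
    simp only [h0] at h1
    have := h1.unique (hasDerivAt_const s 0)
    simpa [tri_def] using this
  · left
    intro t ht
    push Not at hz
    have hcont : Continuous γ := continuous_iff_continuousAt.2 fun t => (hγ t).continuousAt
    obtain ⟨T₀, hT₀, hper₀, hinj⟩ := exists_minimal_period hγ hS hne hT hper
    refine eq_of_tri_eq_zero_of_curv_pos hB hγ hS hT₀ hper₀ hinj (ε := halfCurv B (γ 0))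
      (fun u => ?_) ht
    by_contra! hu
    have hc : Continuous fun u => halfCurv B (γ 0) * halfCurv B (γ u) :=
      continuous_const.mul (Continuous.tri (by fun_prop) (by fun_prop) (by fun_prop))
    obtain ⟨v, hv⟩ := mem_range_of_exists_le_of_exists_ge hc ⟨u, hu⟩ ⟨0, mul_self_nonneg _⟩
    exact mul_ne_zero (hz 0) (hz v) hv

end Convexity

end OrbitConvexity

/-- Every periodic orbit `Γ` of a homogeneous polynomial vector field `X`
of degree 2 on `S²` is convex: for each `p ∈ Γ`, the great circle tangent to `Γ` at `p`
(the great circle with normal `p × X(p)`) intersects `Γ` only at `p`, or `Γ` is entirely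
contained in that great circle. -/
theorem stmt14 (P Q R : MvPolynomial (Fin 3) ℝ)
    (hP : P.IsHomogeneous 2) (hQ : Q.IsHomogeneous 2) (hR : R.IsHomogeneous 2)
    (htan : ∀ p : Fin 3 → ℝ, p ∈ S2 →
      p 0 * eval p P + p 1 * eval p Q + p 2 * eval p R = 0) :
    ∀ Γ, IsPeriodicOrbitOn (Xf P Q R) Γ → ∀ p ∈ Γ,
      Γ ∩ {q ∈ S2 | dot3 (cross3 p (Xf P Q R p)) q = 0} = {p} ∨
      Γ ⊆ {q ∈ S2 | dot3 (cross3 p (Xf P Q R p)) q = 0} := by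
  rintro Γ ⟨γ, T, hγ, hT, hper, hne, hS, rfl⟩ p ⟨s, rfl⟩
  obtain ⟨B, hB, e⟩ := exists_continuous_bilin hP hQ hR
  simp only [e] at hγ ⊢
  have hS : ∀ t, γ t ∈ S2 := fun t => hS ⟨t, rfl⟩
  have htan : ∀ p ∈ S2, dot3 p (B p p) = 0 := fun p hp => by
    rw [← e]; exact htan p hp
  rcases orbit_convex hB htan hγ hS hne hT hper s with h | h
  · left
    ext q
    constructor
    · rintro ⟨⟨t, rfl⟩, -, hq⟩
      exact h t hq
    · rintro rfl
      refine ⟨⟨s, rfl⟩, hS s, ?_⟩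
      change tri _ _ _ = 0
      simp only [tri_def]
      ring
  · right
    rintro _ ⟨t, rfl⟩
    exact ⟨hS t, h t⟩
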